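/- arXiv:1210.6170 — 2 statements merged into one kernel-verified Lean document; each statement's English description precedes it below -/
import Mathlib

section
/- Let n ∈ ℕ, σ > 0, c ∈ ℝⁿ, and let X ⊆ ℝⁿ have non-empty interior. Let H₀ be the set of functions f : X → ℝ of the form f(x) = e^{-‖x-c‖²/σ²}·∑_{|α|=0}^∞ w_α (x-c)^α with real coefficients (w_α) satisfying ∑_{k=0}^∞ (k!/(2/σ²)^k) ∑_{|α|=k} w_α²/C^k_α < ∞, equipped with the inner product ⟨f,g⟩ = ∑_{k=0}^∞ (k!/(2/σ²)^k) ∑_{|α|=k} w_α v_α / C^k_α for f with coefficients (w_α) and g with coefficients (v_α). Then H₀ is a Hilbert space, and the family {φ_{α,c}|_X}_{α ∈ (ℕ∪{0})ⁿ} is an orthonormal basis of H₀. -/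
open scoped RealInnerProductSpace

/-- A Hilbert space of real-valued functions on `X`: a Hilbert space `carrier` together with an
injective linear realization of its elements as functions `X → ℝ` (so that the vector space
operations are pointwise). -/
structure HilbertFunSpace (X : Type*) where
  carrier : Type
  [ng : NormedAddCommGroup carrier]
  [ip : InnerProductSpace ℝ carrier]
  [cs : CompleteSpace carrier]
  toFun : carrier → X → ℝ
  add' : ∀ f g : carrier, toFun (f + g) = toFun f + toFun g
  smul' : ∀ (a : ℝ) (f : carrier), toFun (a • f) = a • toFun f
  inj' : Function.Injective toFun

attribute [instance] HilbertFunSpace.ng HilbertFunSpace.ip HilbertFunSpace.cs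

/-- The function `φ_{α,c}(x) = √((2/σ²)^k C^k_α / k!)·e^{-‖x-c‖²/σ²}·(x-c)^α` where `k = |α|`. -/
noncomputable def phiFn (n : ℕ) (σ : ℝ) (c : EuclideanSpace ℝ (Fin n)) (α : Fin n → ℕ)
    (x : EuclideanSpace ℝ (Fin n)) : ℝ :=
  Real.sqrt ((2 / σ ^ 2) ^ (∑ i, α i) * (Nat.multinomial Finset.univ α : ℝ) /
      ((∑ i, α i).factorial : ℝ)) *
    Real.exp (-‖x - c‖ ^ 2 / σ ^ 2) * ∏ i, (x i - c i) ^ α i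

/-- A real power series that converges everywhere and vanishes on a non-empty open set has zero
coefficients. -/
theorem eq_zero_of_tsum_mul_pow_eq_zero {a : ℕ → ℝ} (ha : ∀ y : ℝ, Summable fun k => a k * y ^ k)
    {U : Set ℝ} (hU : IsOpen U) (hne : U.Nonempty) (h0 : ∀ y ∈ U, ∑' k, a k * y ^ k = 0) :
    a = 0 := by
  set p := FormalMultilinearSeries.ofScalars ℝ a with hp
  have hrad : p.radius = ⊤ := by
    apply FormalMultilinearSeries.radius_eq_top_of_summable_norm
    intro r
    simpa [hp, FormalMultilinearSeries.ofScalars_norm] using (ha r).norm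
  have hps : HasFPowerSeriesOnBall p.sum p 0 ⊤ := by
    simpa [hrad] using p.hasFPowerSeriesOnBall (by simp [hrad])
  have hsum : ∀ y, p.sum y = ∑' k, a k * y ^ k := fun y => by
    simp [hp, FormalMultilinearSeries.sum, mul_comm]
  have han : AnalyticOnNhd ℝ p.sum Set.univ := by
    simpa using hps.analyticOnNhd
  obtain ⟨y₀, hy₀⟩ := hne
  have hzero : p.sum = 0 := by
    refine han.eq_of_eventuallyEq analyticOnNhd_const (z₀ := y₀) ?_
    filter_upwards [hU.mem_nhds hy₀] with y hy
    rw [hsum, h0 y hy]; rfl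
  have hat := hps.hasFPowerSeriesAt
  rw [hzero] at hat
  exact (FormalMultilinearSeries.ofScalars_series_eq_zero (E := ℝ)).mp hat.eq_zero

/-- A real power series in `n` variables that converges absolutely everywhere and vanishes on a
non-empty open box has zero coefficients. -/
theorem eq_zero_of_tsum_mul_prod_pow_eq_zero {n : ℕ} {w : (Fin n → ℕ) → ℝ}
    (hw : ∀ y : Fin n → ℝ, Summable fun α => w α * ∏ i, y i ^ α i)
    {U : Fin n → Set ℝ} (hU : ∀ i, IsOpen (U i)) (hne : ∀ i, (U i).Nonempty)
    (h0 : ∀ y : Fin n → ℝ, (∀ i, y i ∈ U i) → ∑' α, w α * ∏ i, y i ^ α i = 0) : w = 0 := by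
  induction n with
  | zero =>
    ext α
    have := h0 0 (fun i => i.elim0)
    rw [tsum_eq_single α (fun β hβ => (hβ (Subsingleton.elim _ _)).elim)] at this
    simpa using this
  | succ n ih =>
    let e := Fin.consEquiv (fun _ : Fin (n + 1) => ℕ)
    have hterm : ∀ (s : ℝ) (z : Fin n → ℝ) (p : ℕ × (Fin n → ℕ)),
        w (e p) * ∏ i, (Fin.cons s z : Fin (n + 1) → ℝ) i ^ e p i =
          (w (Fin.cons p.1 p.2) * ∏ i, z i ^ p.2 i) * s ^ p.1 := by
      intro s z p
      simp only [e, Fin.consEquiv_apply, Fin.prod_univ_succ, Fin.cons_zero, Fin.cons_succ]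
      change w (Fin.cons p.1 p.2) * _ = _
      ring
    have hsum : ∀ (s : ℝ) (z : Fin n → ℝ), Summable fun p : ℕ × (Fin n → ℕ) =>
        (w (Fin.cons p.1 p.2) * ∏ i, z i ^ p.2 i) * s ^ p.1 := fun s z => by
      simpa only [Function.comp_def, hterm] using
        (e.summable_iff).mpr (hw (Fin.cons s z))
    have hslice : ∀ (k : ℕ) (z : Fin n → ℝ), Summable fun β : Fin n → ℕ =>
        w (Fin.cons k β) * ∏ i, z i ^ β i := fun k z => by
      simpa using (hsum 1 z).prod_factor k
    have hcoeff : ∀ z : Fin n → ℝ, (∀ i, z i ∈ U i.succ) →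
        (fun k => ∑' β : Fin n → ℕ, w (Fin.cons k β) * ∏ i, z i ^ β i) = 0 := by
      intro z hz
      refine eq_zero_of_tsum_mul_pow_eq_zero (fun s => ?_) (hU 0) (hne 0) (fun s hs => ?_)
      · simpa only [tsum_mul_right] using (hsum s z).prod
      · have h := h0 (Fin.cons s z) (Fin.cases hs hz)
        rw [← e.tsum_eq] at h
        simp only [hterm] at h
        rw [(hsum s z).tsum_prod] at h
        simpa only [tsum_mul_right] using h
    have hk : ∀ k, (fun β : Fin n → ℕ => w (Fin.cons k β)) = 0 := fun k =>
      ih (hslice k) (fun i => hU i.succ) (fun i => hne i.succ)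
        (fun z hz => congrFun (hcoeff z hz) k)
    ext α
    have := congrFun (hk (α 0)) (Fin.tail α)
    simpa using this

/-- The product of `n` summable families of nonnegative reals is summable over multi-indices. -/
theorem summable_prod_apply_of_nonneg {n : ℕ} {f : Fin n → ℕ → ℝ} (hf : ∀ i k, 0 ≤ f i k)
    (hs : ∀ i, Summable (f i)) : Summable fun α : Fin n → ℕ => ∏ i, f i (α i) := by
  induction n with
  | zero => exact Summable.of_finite
  | succ n ih =>
    rw [← (Fin.consEquiv (fun _ : Fin (n + 1) => ℕ)).summable_iff]
    simp only [Function.comp_def, Fin.consEquiv_apply, Fin.prod_univ_succ, Fin.cons_zero,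
      Fin.cons_succ]
    have htail := ih (f := fun i => f i.succ) (fun i => hf i.succ) (fun i => hs i.succ)
    have hnonneg : 0 ≤ fun β : Fin n → ℕ => ∏ i, f i.succ (β i) := fun β =>
      Finset.prod_nonneg fun i _ => hf i.succ _
    have h0 : 0 ≤ f 0 := hf 0
    have hmul := (hs 0).mul_of_nonneg htail h0 hnonneg
    exact hmul

/-- The normalizing factor `√(t^k C^k_α / k!)`, `k = |α|`, of the monomial with exponent `α`. -/
noncomputable def monomialScale {n : ℕ} (t : ℝ) (α : Fin n → ℕ) : ℝ :=
  Real.sqrt (t ^ (∑ i, α i) * (Nat.multinomial Finset.univ α : ℝ) / ((∑ i, α i).factorial : ℝ))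

section monomialScale

variable {n : ℕ} {t : ℝ}

theorem multinomial_cast_pos (α : Fin n → ℕ) : (0 : ℝ) < Nat.multinomial Finset.univ α :=
  Nat.cast_pos.mpr (Nat.multinomial_pos Finset.univ α)

theorem monomialScale_pos (ht : 0 < t) (α : Fin n → ℕ) : 0 < monomialScale t α := by
  have := multinomial_cast_pos α
  unfold monomialScale
  positivity

theorem monomialScale_sq (ht : 0 < t) (α : Fin n → ℕ) : monomialScale t α ^ 2 =
    t ^ (∑ i, α i) * (Nat.multinomial Finset.univ α : ℝ) / ((∑ i, α i).factorial : ℝ) := by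
  have := multinomial_cast_pos α
  exact Real.sq_sqrt (by positivity)

theorem monomialScale_sq_eq_prod (ht : 0 < t) (α : Fin n → ℕ) :
    monomialScale t α ^ 2 = ∏ i, t ^ α i / ((α i).factorial : ℝ) := by
  rw [monomialScale_sq ht, Finset.prod_div_distrib, Finset.prod_pow_eq_pow_sum,
    ← Nat.multinomial_spec Finset.univ α]
  have := multinomial_cast_pos α
  push_cast
  have : ∏ i, ((α i).factorial : ℝ) ≠ 0 := by positivity
  field_simp

theorem factorial_div_pow_mul_div_multinomial (ht : 0 < t) (α : Fin n → ℕ) (x : ℝ) :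
    ((∑ i, α i).factorial : ℝ) / t ^ (∑ i, α i) * x / (Nat.multinomial Finset.univ α : ℝ) =
      x / monomialScale t α ^ 2 := by
  have := multinomial_cast_pos α
  rw [monomialScale_sq ht]
  field_simp

theorem summable_sq_monomialScale_mul_prod_pow (ht : 0 < t) (y : Fin n → ℝ) :
    Summable fun α : Fin n → ℕ => (monomialScale t α * ∏ i, y i ^ α i) ^ 2 := by
  have h : Summable fun α : Fin n → ℕ => ∏ i, (t * y i ^ 2) ^ α i / ((α i).factorial : ℝ) :=
    summable_prod_apply_of_nonneg (f := fun i k => (t * y i ^ 2) ^ k / (k.factorial : ℝ))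
      (fun i k => by positivity) (fun i => Real.summable_pow_div_factorial _)
  refine h.congr fun α => ?_
  rw [mul_pow, monomialScale_sq_eq_prod ht, ← Finset.prod_pow, ← Finset.prod_mul_distrib]
  refine Finset.prod_congr rfl fun i _ => ?_
  rw [mul_pow]
  ring

theorem summable_mul_monomialScale_mul_prod_pow (ht : 0 < t) {a : (Fin n → ℕ) → ℝ}
    (ha : Summable fun α => a α ^ 2) (y : Fin n → ℝ) :
    Summable fun α : Fin n → ℕ => a α * monomialScale t α * ∏ i, y i ^ α i := by
  refine .of_norm_bounded (ha.add (summable_sq_monomialScale_mul_prod_pow ht y)) fun α => ?_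
  rw [Real.norm_eq_abs, abs_le, mul_assoc]
  constructor <;>
  nlinarith [sq_nonneg (a α + monomialScale t α * ∏ i, y i ^ α i),
    sq_nonneg (a α - monomialScale t α * ∏ i, y i ^ α i), sq_nonneg (a α),
    sq_nonneg (monomialScale t α * ∏ i, y i ^ α i)]

end monomialScale

theorem summable_sq_iff_memℓp_two {ι : Type*} {a : ι → ℝ} :
    (Summable fun i => a i ^ 2) ↔ Memℓp a 2 := by
  rw [memℓp_gen_iff (by norm_num)]
  simp

section gaussianSeries

variable {n : ℕ}

/-- The function `x ↦ e^{-‖x-c‖²/σ²} ∑_α w_α (x-c)^α`. -/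
noncomputable def gaussianSeries (σ : ℝ) (c : EuclideanSpace ℝ (Fin n)) (w : (Fin n → ℕ) → ℝ)
    (x : EuclideanSpace ℝ (Fin n)) : ℝ :=
  Real.exp (-‖x - c‖ ^ 2 / σ ^ 2) * ∑' α : Fin n → ℕ, w α * ∏ i, (x i - c i) ^ α i

theorem gaussianSeries_add (σ : ℝ) (c : EuclideanSpace ℝ (Fin n)) {w v : (Fin n → ℕ) → ℝ}
    (hw : ∀ y : Fin n → ℝ, Summable fun α => w α * ∏ i, y i ^ α i)
    (hv : ∀ y : Fin n → ℝ, Summable fun α => v α * ∏ i, y i ^ α i) :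
    gaussianSeries σ c (w + v) = gaussianSeries σ c w + gaussianSeries σ c v := by
  ext x
  simp only [gaussianSeries, Pi.add_apply, add_mul, ← mul_add]
  rw [(hw fun i => x i - c i).tsum_add (hv fun i => x i - c i)]

theorem gaussianSeries_smul (σ : ℝ) (c : EuclideanSpace ℝ (Fin n)) (r : ℝ)
    (w : (Fin n → ℕ) → ℝ) : gaussianSeries σ c (r • w) = r • gaussianSeries σ c w := by
  ext x
  simp only [gaussianSeries, Pi.smul_apply, smul_eq_mul, mul_assoc, tsum_mul_left]
  ring

theorem gaussianSeries_single (σ : ℝ) (c : EuclideanSpace ℝ (Fin n)) (α : Fin n → ℕ) (r : ℝ)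
    (x : EuclideanSpace ℝ (Fin n)) : gaussianSeries σ c (Pi.single α r) x =
      r * Real.exp (-‖x - c‖ ^ 2 / σ ^ 2) * ∏ i, (x i - c i) ^ α i := by
  rw [gaussianSeries, tsum_eq_single α fun β hβ => by simp [hβ]]
  simp only [Pi.single_eq_same]
  ring

theorem eq_of_gaussianSeries_eqOn {σ : ℝ} {c : EuclideanSpace ℝ (Fin n)}
    {X : Set (EuclideanSpace ℝ (Fin n))} (hX : (interior X).Nonempty) {w v : (Fin n → ℕ) → ℝ}
    (hw : ∀ y : Fin n → ℝ, Summable fun α => w α * ∏ i, y i ^ α i)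
    (hv : ∀ y : Fin n → ℝ, Summable fun α => v α * ∏ i, y i ^ α i)
    (h : Set.EqOn (gaussianSeries σ c w) (gaussianSeries σ c v) X) : w = v := by
  obtain ⟨x₀, hx₀⟩ := hX
  let g : (Fin n → ℝ) → EuclideanSpace ℝ (Fin n) := fun y => WithLp.toLp 2 y + c
  have hg : Continuous g := (PiLp.continuous_toLp 2 _).add continuous_const
  have hgx : g (fun i => x₀ i - c i) = x₀ := by ext i; simp [g]
  obtain ⟨U, hU, hUX⟩ := isOpen_pi_iff'.mp ((isOpen_interior (s := X)).preimage hg)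
    (fun i => x₀ i - c i) (by rwa [Set.mem_preimage, hgx])
  have hsub : ∀ y : Fin n → ℝ, Summable fun α => (w - v) α * ∏ i, y i ^ α i := fun y => by
    simpa only [Pi.sub_apply, sub_mul] using (hw y).sub (hv y)
  refine sub_eq_zero.mp (eq_zero_of_tsum_mul_prod_pow_eq_zero hsub (fun i => (hU i).1)
    (fun i => ⟨_, (hU i).2⟩) fun y hy => ?_)
  have hmem : g y ∈ X := interior_subset (hUX fun i _ => hy i)
  have := mul_left_cancel₀ (Real.exp_ne_zero _) (h hmem)
  simp only [g, PiLp.add_apply, add_sub_cancel_right] at this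
  simp only [Pi.sub_apply, sub_mul]
  rw [(hw y).tsum_sub (hv y), this, sub_self]

end gaussianSeries

/-- The Hilbert function space on `X` obtained by realizing `a ∈ ℓ²` as the Gaussian series with
coefficients `a α * monomialScale (2 / σ ^ 2) α`. -/
noncomputable def gaussianHilbertFunSpace {n : ℕ} {σ : ℝ} (hσ : 0 < σ)
    (c : EuclideanSpace ℝ (Fin n)) {X : Set (EuclideanSpace ℝ (Fin n))}
    (hX : (interior X).Nonempty) : HilbertFunSpace X where
  carrier := lp (fun _ : Fin n → ℕ => ℝ) 2
  toFun a x := gaussianSeries σ c (fun α => a α * monomialScale (2 / σ ^ 2) α) x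
  add' a b := by
    have ht : 0 < 2 / σ ^ 2 := by positivity
    have := gaussianSeries_add σ c
      (summable_mul_monomialScale_mul_prod_pow ht (summable_sq_iff_memℓp_two.mpr a.2))
      (summable_mul_monomialScale_mul_prod_pow ht (summable_sq_iff_memℓp_two.mpr b.2))
    ext x
    convert! congrFun this x using 2
    ext α
    exact add_mul _ _ _
  smul' r a := by
    ext x
    convert! congrFun (gaussianSeries_smul σ c r _) x using 2
    ext α
    exact mul_assoc _ _ _
  inj' a b hab := by
    have ht : 0 < 2 / σ ^ 2 := by positivity
    have := eq_of_gaussianSeries_eqOn hX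
      (summable_mul_monomialScale_mul_prod_pow ht (summable_sq_iff_memℓp_two.mpr a.2))
      (summable_mul_monomialScale_mul_prod_pow ht (summable_sq_iff_memℓp_two.mpr b.2))
      (fun x hx => congrFun hab ⟨x, hx⟩)
    ext α
    exact mul_right_cancel₀ (monomialScale_pos ht α).ne' (congrFun this α)

/-- the space `H₀` of functions
`f(x) = e^{-‖x-c‖²/σ²}·∑_α w_α (x-c)^α` with `∑_k (k!/(2/σ²)^k) ∑_{|α|=k} w_α²/C^k_α < ∞`,
with inner product `⟨f,g⟩ = ∑_k (k!/(2/σ²)^k) ∑_{|α|=k} w_α v_α / C^k_α`, is a Hilbert space,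
and `{φ_{α,c}|_X}_α` is an orthonormal basis of it. -/
theorem H0_hilbert_space_orthonormal_basis (n : ℕ) (σ : ℝ) (hσ : 0 < σ)
    (c : EuclideanSpace ℝ (Fin n)) (X : Set (EuclideanSpace ℝ (Fin n)))
    (hX : (interior X).Nonempty) :
    ∃ S : HilbertFunSpace X,
      (∀ f : X → ℝ, f ∈ Set.range S.toFun ↔
        ∃ w : (Fin n → ℕ) → ℝ,
          (Summable fun α : Fin n → ℕ =>
            ((∑ i, α i).factorial : ℝ) / (2 / σ ^ 2) ^ (∑ i, α i) * w α ^ 2 /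
              (Nat.multinomial Finset.univ α : ℝ)) ∧
          ∀ x : X, f x = Real.exp (-‖(x : EuclideanSpace ℝ (Fin n)) - c‖ ^ 2 / σ ^ 2) *
            ∑' α : Fin n → ℕ, w α * ∏ i, ((x : EuclideanSpace ℝ (Fin n)) i - c i) ^ α i) ∧
      (∀ (w v : (Fin n → ℕ) → ℝ) (F G : S.carrier),
        (Summable fun α : Fin n → ℕ =>
          ((∑ i, α i).factorial : ℝ) / (2 / σ ^ 2) ^ (∑ i, α i) * w α ^ 2 /
            (Nat.multinomial Finset.univ α : ℝ)) →
        (Summable fun α : Fin n → ℕ =>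
          ((∑ i, α i).factorial : ℝ) / (2 / σ ^ 2) ^ (∑ i, α i) * v α ^ 2 /
            (Nat.multinomial Finset.univ α : ℝ)) →
        (∀ x : X, S.toFun F x = Real.exp (-‖(x : EuclideanSpace ℝ (Fin n)) - c‖ ^ 2 / σ ^ 2) *
          ∑' α : Fin n → ℕ, w α * ∏ i, ((x : EuclideanSpace ℝ (Fin n)) i - c i) ^ α i) →
        (∀ x : X, S.toFun G x = Real.exp (-‖(x : EuclideanSpace ℝ (Fin n)) - c‖ ^ 2 / σ ^ 2) *
          ∑' α : Fin n → ℕ, v α * ∏ i, ((x : EuclideanSpace ℝ (Fin n)) i - c i) ^ α i) →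
        ⟪F, G⟫ = ∑' α : Fin n → ℕ,
          ((∑ i, α i).factorial : ℝ) / (2 / σ ^ 2) ^ (∑ i, α i) * (w α * v α) /
            (Nat.multinomial Finset.univ α : ℝ)) ∧
      ∃ b : (Fin n → ℕ) → S.carrier,
        (∀ α : Fin n → ℕ, S.toFun (b α) = fun x : X => phiFn n σ c α x) ∧
        Orthonormal ℝ b ∧
        (Submodule.span ℝ (Set.range b)).topologicalClosure = ⊤ := by
  have ht : 0 < 2 / σ ^ 2 := by positivity
  simp only [factorial_div_pow_mul_div_multinomial ht, ← div_pow]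
  have hscale : ∀ (w : (Fin n → ℕ) → ℝ) α,
      w α / monomialScale (2 / σ ^ 2) α * monomialScale (2 / σ ^ 2) α = w α := fun w α =>
    div_mul_cancel₀ _ (monomialScale_pos ht α).ne'
  have hcoeff : ∀ (w : (Fin n → ℕ) → ℝ) (F : lp (fun _ : Fin n → ℕ => ℝ) 2),
      (Summable fun α => (w α / monomialScale (2 / σ ^ 2) α) ^ 2) →
      (∀ x : X, (gaussianHilbertFunSpace hσ c hX).toFun F x = gaussianSeries σ c w x) →
      ∀ α, F α = w α / monomialScale (2 / σ ^ 2) α := by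
    intro w F hw hF α
    have hw' := summable_mul_monomialScale_mul_prod_pow ht hw
    simp only [hscale] at hw'
    have := eq_of_gaussianSeries_eqOn hX
      (summable_mul_monomialScale_mul_prod_pow ht (summable_sq_iff_memℓp_two.mpr F.2)) hw'
      (fun x hx => hF ⟨x, hx⟩)
    rw [eq_div_iff (monomialScale_pos ht α).ne']
    exact congrFun this α
  refine ⟨gaussianHilbertFunSpace hσ c hX, fun f => ⟨?_, ?_⟩, ?_, ?_⟩
  · rintro ⟨a, rfl⟩
    refine ⟨fun α => a.1 α * monomialScale (2 / σ ^ 2) α, ?_, fun x => rfl⟩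
    simp only [mul_div_cancel_right₀ _ (monomialScale_pos ht _).ne']
    exact summable_sq_iff_memℓp_two.mpr a.2
  · rintro ⟨w, hw, hf⟩
    refine ⟨⟨fun α => w α / monomialScale (2 / σ ^ 2) α, summable_sq_iff_memℓp_two.mp hw⟩, ?_⟩
    ext x
    rw [hf]
    change gaussianSeries σ c
      (fun α => w α / monomialScale (2 / σ ^ 2) α * monomialScale (2 / σ ^ 2) α) x = _
    simp only [hscale]
    rfl
  · intro w v F G hw hv hF hG
    refine (lp.inner_eq_tsum (𝕜 := ℝ) (G := fun _ : Fin n → ℕ => ℝ) F G).trans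
      (tsum_congr fun α => ?_)
    rw [hcoeff w F hw hF α, hcoeff v G hv hG α]
    simp only [RCLike.inner_apply, conj_trivial]
    ring
  · let b : HilbertBasis (Fin n → ℕ) ℝ (lp (fun _ : Fin n → ℕ => ℝ) 2) :=
      .ofRepr (LinearIsometryEquiv.refl ℝ _)
    refine ⟨b, fun α => ?_, b.orthonormal, b.dense_span⟩
    ext x
    have hb : b α = lp.single 2 α (1 : ℝ) := (b.repr_symm_single α).symm
    rw [hb]
    refine Eq.trans ?_ (gaussianSeries_single σ c α (monomialScale (2 / σ ^ 2) α) x)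
    change gaussianSeries σ c _ _ = _
    congr 1
    ext β
    rcases eq_or_ne β α with rfl | hβ
    · simp
    · simp [hβ]
end

section
/- Let n ∈ ℕ, σ > 0, and let X ⊆ ℝⁿ have non-empty interior. Let K(x,t) = exp(-‖x-t‖²/σ²) and let H_K be the RKHS of K on X. For every c ∈ ℝⁿ (not necessarily in X), the function φ_{0,c}(x) = exp(-‖x-c‖²/σ²), restricted to X, belongs to H_K and ‖φ_{0,c}‖_{H_K} = 1. -/
open scoped RealInnerProductSpace

/-- `S` is a reproducing kernel Hilbert space with kernel `K`. -/
def HilbertFunSpace.IsRKHS {X : Type*} (S : HilbertFunSpace X) (K : X → X → ℝ) : Prop :=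
  ∀ x : X, ∃ kx : S.carrier, S.toFun kx = (fun y => K x y) ∧
    ∀ f : S.carrier, ⟪f, kx⟫ = S.toFun f x

/-- The vector `(√(rⁿ / n!) tⁿ)ₙ` of `ℓ²`, a feature map of the kernel `(s, t) ↦ exp (r s t)`. -/
noncomputable def expFeature (r : ℝ) (hr : 0 ≤ r) (t : ℝ) : lp (fun _ : ℕ => ℝ) 2 :=
  ⟨fun n => √(r ^ n / n.factorial) * t ^ n, memℓp_gen (by
    refine (Real.summable_pow_div_factorial (r * t ^ 2)).congr fun n => ?_
    have h : 0 ≤ r ^ n / n.factorial := by positivity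
    simp only [ENNReal.toReal_ofNat, Real.rpow_ofNat, Real.norm_eq_abs, sq_abs]
    rw [mul_pow (√_), Real.sq_sqrt h]
    ring)⟩

lemma expFeature_apply (r : ℝ) (hr : 0 ≤ r) (t : ℝ) (n : ℕ) :
    expFeature r hr t n = √(r ^ n / n.factorial) * t ^ n := rfl

lemma inner_expFeature (r : ℝ) (hr : 0 ≤ r) (s t : ℝ) :
    ⟪expFeature r hr s, expFeature r hr t⟫ = Real.exp (r * s * t) := by
  have h := NormedSpace.expSeries_div_hasSum_exp (r * s * t)
  rw [← Real.exp_eq_exp_ℝ] at h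
  refine (lp.hasSum_inner _ _).unique (h.congr_fun fun n => ?_)
  have hn : 0 ≤ r ^ n / n.factorial := by positivity
  rw [expFeature_apply, expFeature_apply, Real.inner_apply]
  linear_combination (s ^ n * t ^ n) * Real.mul_self_sqrt hn

lemma hasFPowerSeriesOnBall_inner_expFeature (r : ℝ) (hr : 0 ≤ r) (w : lp (fun _ : ℕ => ℝ) 2) :
    HasFPowerSeriesOnBall (fun t => ⟪w, expFeature r hr t⟫)
      (FormalMultilinearSeries.ofScalars ℝ fun n => w n * √(r ^ n / n.factorial)) 0 ⊤ := by
  have key (t : ℝ) : HasSum (fun n => w n * √(r ^ n / n.factorial) * t ^ n)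
      ⟪w, expFeature r hr t⟫ := by
    refine (lp.hasSum_inner w (expFeature r hr t)).congr_fun fun n => ?_
    rw [expFeature_apply, Real.inner_apply, mul_assoc]
  refine ⟨?_, by simp, fun {y} _ => ?_⟩
  · rw [FormalMultilinearSeries.radius_eq_top_of_summable_norm]
    intro t
    refine (key t).summable.norm.congr fun n => ?_
    simp
  · simpa only [FormalMultilinearSeries.ofScalars_apply_eq, smul_eq_mul, zero_add] using key y

lemma dense_range_linearCombination_expFeature (r : ℝ) (hr : 0 < r) (I : Set ℝ)
    (hI : I ∈ nhds 0) :
    DenseRange (Finsupp.linearCombination ℝ fun t : I => expFeature r hr.le t) := by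
  have hspan : (Submodule.span ℝ (Set.range fun t : I => expFeature r hr.le t))ᗮ = ⊥ := by
    rw [Submodule.eq_bot_iff]
    intro w hw
    have hzero : (fun t => ⟪w, expFeature r hr.le t⟫) =ᶠ[nhds 0] 0 := by
      filter_upwards [hI] with t ht
      exact (Submodule.mem_orthogonal' _ _).1 hw _ (Submodule.subset_span ⟨⟨t, ht⟩, rfl⟩)
    have hcoeff := ((hasFPowerSeriesOnBall_inner_expFeature r hr.le w).hasFPowerSeriesAt.congr
      hzero).eq_zero
    rw [FormalMultilinearSeries.ofScalars_series_eq_zero] at hcoeff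
    ext n
    have hpos : √(r ^ n / n.factorial) ≠ 0 := by positivity
    exact (mul_eq_zero.1 (congrFun hcoeff n)).resolve_right hpos
  rw [← Submodule.topologicalClosure_eq_top_iff, ← Submodule.dense_iff_topologicalClosure_eq_top,
    ← Finsupp.range_linearCombination] at hspan
  rwa [LinearMap.coe_range] at hspan

lemma inner_linearCombination_eq_of_inner_eq {ι E F : Type*}
    [NormedAddCommGroup E] [InnerProductSpace ℝ E] [NormedAddCommGroup F] [InnerProductSpace ℝ F]
    {v : ι → E} {w : ι → F} (h : ∀ i j, ⟪v i, v j⟫ = ⟪w i, w j⟫) (p q : ι →₀ ℝ) :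
    ⟪Finsupp.linearCombination ℝ v p, Finsupp.linearCombination ℝ v q⟫ =
      ⟪Finsupp.linearCombination ℝ w p, Finsupp.linearCombination ℝ w q⟫ := by
  simp [Finsupp.linearCombination_apply, Finsupp.sum_inner, Finsupp.inner_sum,
    real_inner_smul_left, real_inner_smul_right, h]

/-- A family in a Hilbert space, indexed by a neighbourhood of `0` and with Gram kernel
`exp (r s t)`, extends to all of `ℝ` with the same Gram kernel, weakly analytically. -/
lemma exists_extension_of_inner_eq_exp {E : Type*} [NormedAddCommGroup E] [InnerProductSpace ℝ E]
    [CompleteSpace E] (r : ℝ) (hr : 0 < r) (I : Set ℝ) (hI : I ∈ nhds 0) (h : I → E)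
    (hh : ∀ s t : I, ⟪h s, h t⟫ = Real.exp (r * s * t)) :
    ∃ H : ℝ → E, (∀ t : I, H t = h t) ∧ (∀ s t, ⟪H s, H t⟫ = Real.exp (r * s * t)) ∧
      ∀ w : E, AnalyticOnNhd ℝ (fun t => ⟪w, H t⟫) Set.univ := by
  set A := Finsupp.linearCombination ℝ fun t : I => expFeature r hr.le t
  set B := Finsupp.linearCombination ℝ h
  have hA : DenseRange A := dense_range_linearCombination_expFeature r hr I hI
  have hinner (p q : I →₀ ℝ) : ⟪B p, B q⟫ = ⟪A p, A q⟫ :=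
    inner_linearCombination_eq_of_inner_eq (fun s t => by rw [hh, inner_expFeature]) p q
  have hnorm (p : I →₀ ℝ) : ‖B p‖ ≤ 1 * ‖A p‖ := by
    rw [one_mul, norm_eq_sqrt_real_inner, norm_eq_sqrt_real_inner, hinner]
  set U := B.extendOfNorm A
  have hU (p : I →₀ ℝ) : U (A p) = B p := LinearMap.extendOfNorm_eq hA ⟨1, hnorm⟩ p
  have hUinner (a b : lp (fun _ : ℕ => ℝ) 2) : ⟪U a, U b⟫ = ⟪a, b⟫ := by
    refine hA.induction_on₂ (p := fun a b => ⟪U a, U b⟫ = ⟪a, b⟫)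
      (isClosed_eq (by fun_prop) (by fun_prop)) (fun p q => ?_) a b
    rw [hU, hU, hinner]
  refine ⟨fun t => U (expFeature r hr.le t), fun t => ?_, fun s t => ?_, fun w => ?_⟩
  · simpa [A, B] using hU (Finsupp.single t 1)
  · rw [hUinner, inner_expFeature]
  · simp_rw [← ContinuousLinearMap.adjoint_inner_left]
    have := (hasFPowerSeriesOnBall_inner_expFeature r hr.le (U.adjoint w)).analyticOnNhd
    simpa using this

/-- for every `c ∈ ℝⁿ` (not necessarily in `X`), the function
`φ_{0,c}(x) = exp(-‖x-c‖²/σ²)`, restricted to `X`, belongs to the Gaussian RKHS `H_K` on `X`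
and has norm `1`. -/
theorem gaussian_rkhs_phi_zero_c_norm_one (n : ℕ) (σ : ℝ) (hσ : 0 < σ)
    (X : Set (EuclideanSpace ℝ (Fin n))) (hX : (interior X).Nonempty)
    (S : HilbertFunSpace X)
    (hS : S.IsRKHS (fun x t : X =>
      Real.exp (-‖(x : EuclideanSpace ℝ (Fin n)) - (t : EuclideanSpace ℝ (Fin n))‖ ^ 2 / σ ^ 2)))
    (c : EuclideanSpace ℝ (Fin n)) :
    ∃ g : S.carrier,
      S.toFun g = (fun x : X => Real.exp (-‖(x : EuclideanSpace ℝ (Fin n)) - c‖ ^ 2 / σ ^ 2)) ∧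
      ‖g‖ = 1 := by
  obtain ⟨x₀, hx₀⟩ := hX
  choose k hk hrep using hS
  have hkk (x y : X) : ⟪k x, k y⟫ = Real.exp (-‖(x : EuclideanSpace ℝ (Fin n)) - y‖ ^ 2 / σ ^ 2) := by
    rw [hrep, hk]
  by_cases hc : c = x₀
  · subst hc
    refine ⟨k ⟨c, interior_subset hx₀⟩, ?_, ?_⟩
    · rw [hk]
      simp_rw [norm_sub_rev]
    · rw [norm_eq_sqrt_real_inner, hkk]
      simp
  set u := c - x₀ with hu
  have hu0 : 0 < ‖u‖ := norm_pos_iff.2 (sub_ne_zero.2 hc)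
  set r := 2 * ‖u‖ ^ 2 / σ ^ 2 with hr
  have hr0 : 0 < r := by positivity
  set I : Set ℝ := (fun t : ℝ => x₀ + t • u) ⁻¹' X with hI
  have hI0 : I ∈ nhds 0 := by
    have hcont : ContinuousAt (fun t : ℝ => x₀ + t • u) 0 := by fun_prop
    exact hcont (by simpa using mem_interior_iff_mem_nhds.1 hx₀)
  obtain ⟨H, hHI, hHH, hHan⟩ := exists_extension_of_inner_eq_exp r hr0 I hI0
    (fun t => Real.exp (r / 2 * (t : ℝ) ^ 2) • k ⟨x₀ + (t : ℝ) • u, t.2⟩) (fun s t => by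
      rw [real_inner_smul_left, real_inner_smul_right, hkk, ← Real.exp_add, ← Real.exp_add]
      simp only [add_sub_add_left_eq_sub, ← sub_smul, norm_smul, mul_pow, Real.norm_eq_abs, sq_abs]
      congr 1
      rw [hr]
      ring)
  refine ⟨Real.exp (-(r / 2)) • H 1, ?_, ?_⟩
  · funext y
    have hline (t : ℝ) : ‖x₀ + t • u - y‖ ^ 2 =
        ‖x₀ - y‖ ^ 2 + 2 * (t * ⟪x₀ - y, u⟫) + t ^ 2 * ‖u‖ ^ 2 := by
      rw [add_sub_right_comm, norm_add_sq_real, real_inner_smul_right, norm_smul, mul_pow,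
        Real.norm_eq_abs, sq_abs]
    have hR : AnalyticOnNhd ℝ (fun t : ℝ => Real.exp (r / 2 * t ^ 2) *
        Real.exp (-‖x₀ + t • u - y‖ ^ 2 / σ ^ 2)) Set.univ := by
      simp_rw [hline, div_eq_mul_inv]
      intro t _
      fun_prop
    have heq := (hHan (k y)).eq_of_eventuallyEq hR (z₀ := 0) (by
      filter_upwards [hI0] with t ht
      rw [hHI ⟨t, ht⟩, real_inner_smul_right, hkk, norm_sub_rev])
    have h1 := congrFun heq 1
    simp only [one_smul, one_pow, mul_one, hu, add_sub_cancel] at h1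
    rw [← hrep, real_inner_smul_left, real_inner_comm, h1, ← mul_assoc, ← Real.exp_add,
      norm_sub_rev c]
    simp
  · rw [norm_eq_sqrt_real_inner, real_inner_smul_left, real_inner_smul_right, hHH,
      ← Real.exp_add, ← Real.exp_add, Real.sqrt_eq_one, Real.exp_eq_one_iff]
    ring
end
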